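/- arXiv:1609.05824 — 2 statements merged into one kernel-verified Lean document; each statement's English description precedes it below -/
import Mathlib

section
/- Let k ≥ 6 and let G be a finite simple graph with ch_3^d(G) > k such that every proper subgraph H of G (obtained from G by deleting at least one vertex or at least one edge) satisfies ch_3^d(H) ≤ k. Then G contains no seven pairwise distinct vertices v_1, v_2, v_3, v_4, v_5, w, u such that v_1v_2v_3v_4v_5v_1 is a cycle in G, w is adjacent to v_1 and to u, deg(v_1) = deg(v_2) = 3, deg(v_3) = deg(v_5) = deg(w) = 2, deg(v_4) ≥ 3, and deg(u) ≥ 3. -/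
open SimpleGraph

/-- `φ` is a proper coloring of `G` that is 3-dynamic: every vertex `v` sees at least
`min 3 (deg v)` distinct colors on its neighborhood. -/
def IsDyn3Coloring {V : Type*} (G : SimpleGraph V) (φ : V → ℕ) : Prop :=
  (∀ u v, G.Adj u v → φ u ≠ φ v) ∧
  ∀ v, min 3 (G.neighborSet v).ncard ≤ (φ '' G.neighborSet v).ncard

/-- `G` is 3-dynamically colorable from the list assignment `L`. -/
def Dyn3ListColorable {V : Type*} (G : SimpleGraph V) (L : V → Finset ℕ) : Prop :=
  ∃ φ : V → ℕ, IsDyn3Coloring G φ ∧ ∀ v, φ v ∈ L v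

/-- `ch_3^d(G) ≤ k` : `G` is 3-dynamically `L`-colorable for every list assignment `L`
with `|L v| ≥ k` for all `v`. -/
def Ch3dLE {V : Type*} (G : SimpleGraph V) (k : ℕ) : Prop :=
  ∀ L : V → Finset ℕ, (∀ v, k ≤ (L v).card) → Dyn3ListColorable G L

/-- `mad(G) < c` : every nonempty subgraph has average degree `< c`. -/
def MadLT {V : Type*} (G : SimpleGraph V) (c : ℚ) : Prop :=
  ∀ H : G.Subgraph, H.verts.Nonempty →
    (2 * H.edgeSet.ncard : ℚ) / (H.verts.ncard : ℚ) < c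

/-- `mad(G) ≤ c` : every nonempty subgraph has average degree `≤ c`. -/
def MadLE {V : Type*} (G : SimpleGraph V) (c : ℚ) : Prop :=
  ∀ H : G.Subgraph, H.verts.Nonempty →
    (2 * H.edgeSet.ncard : ℚ) / (H.verts.ncard : ℚ) ≤ c

/-- Every proper subgraph of `G` (deleting at least one vertex or edge) has
`ch_3^d ≤ k`. -/
def ProperSubgraphsCh3dLE {V : Type*} (G : SimpleGraph V) (k : ℕ) : Prop :=
  ∀ H : G.Subgraph, H ≠ ⊤ → Ch3dLE H.coe k

/-- `x ∈ W_i(G)` : `x` has degree 3 and exactly `i` neighbors of degree 2. -/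
def Wmem {V : Type*} (G : SimpleGraph V) (i : ℕ) (x : V) : Prop :=
  (G.neighborSet x).ncard = 3 ∧
    {y | G.Adj x y ∧ (G.neighborSet y).ncard = 2}.ncard = i

/-- `y` is a weak neighbor of `x` : they are distinct and have a common neighbor of
degree 2. -/
def WeakAdj {V : Type*} (G : SimpleGraph V) (x y : V) : Prop :=
  x ≠ y ∧ ∃ w, G.Adj x w ∧ G.Adj y w ∧ (G.neighborSet w).ncard = 2

lemma aux_ext {V : Type*} [Fintype V] (G : SimpleGraph V) (k : ℕ)
    (hmin : ProperSubgraphsCh3dLE G k) (D : Set V) (hD : D.Nonempty) (L : V → Finset ℕ)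
    (hL : ∀ v, k ≤ (L v).card) :
    ∃ ψ : V → ℕ, (∀ v, v ∉ D → ψ v ∈ L v) ∧
      (∀ a b, a ∉ D → b ∉ D → G.Adj a b → ψ a ≠ ψ b) ∧
      ∀ v, v ∉ D → min 3 (G.neighborSet v \ D).ncard ≤ (ψ '' (G.neighborSet v \ D)).ncard := by
  classical
  let H : G.Subgraph := (⊤ : G.Subgraph).induce Dᶜ
  have hv : H.verts = Dᶜ := rfl
  have hH : H ≠ ⊤ := by
    intro h
    obtain ⟨d, hd⟩ := hD
    have : d ∈ H.verts := by rw [h]; trivial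
    exact this hd
  obtain ⟨φ, ⟨hp, hd⟩, hl⟩ := hmin H hH (fun v => L v.1) (fun v => hL v.1)
  let ψ : V → ℕ := fun v => if h : v ∈ H.verts then φ ⟨v, h⟩ else 0
  have hψ : ∀ v : H.verts, ψ v.1 = φ v := by
    intro v
    simp only [ψ, v.2, dif_pos]
  have hadj : ∀ a b : H.verts, H.coe.Adj a b ↔ G.Adj a.1 b.1 := by
    intro a b
    have ha : a.1 ∈ Dᶜ := a.2
    have hb : b.1 ∈ Dᶜ := b.2
    simp only [SimpleGraph.Subgraph.coe_adj]
    constructor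
    · intro h; exact h.adj_sub
    · intro h; exact ⟨ha, hb, h⟩
  refine ⟨ψ, ?_, ?_, ?_⟩
  · intro v hvD
    rw [hψ ⟨v, hvD⟩]; exact hl _
  · intro a b ha hb hab
    rw [hψ ⟨a, ha⟩, hψ ⟨b, hb⟩]
    exact hp _ _ ((hadj _ _).2 hab)
  · intro v hvD
    have h := hd ⟨v, hvD⟩
    have e1 : G.neighborSet v \ D = Subtype.val '' (H.coe.neighborSet ⟨v, hvD⟩) := by
      ext y
      constructor
      · rintro ⟨h1, h2⟩
        exact ⟨⟨y, h2⟩, (hadj _ _).2 h1, rfl⟩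
      · rintro ⟨z, h1, rfl⟩
        exact ⟨(hadj _ _).1 h1, z.2⟩
    have e2 : ψ '' (G.neighborSet v \ D) = φ '' (H.coe.neighborSet ⟨v, hvD⟩) := by
      rw [e1, Set.image_image]
      exact Set.image_congr (fun z _ => hψ z)
    rw [e2, e1, Set.ncard_image_of_injective _ Subtype.val_injective]
    exact h

lemma aux_pick (L : Finset ℕ) (F : Finset ℕ) (n : ℕ) (hF : F.card ≤ n) (h : n < L.card) :
    ∃ c ∈ L, c ∉ F := Finset.exists_mem_notMem_of_card_lt_card (by omega)

lemma aux_comb (L1 L3 L5 Lw : Finset ℕ) (h1 : 2 ≤ L1.card) (h3 : 2 ≤ L3.card)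
    (h5 : 3 ≤ L5.card) (hw : 2 ≤ Lw.card) :
    ∃ a ∈ L1, ∃ b ∈ L3, ∃ c ∈ L5, ∃ d ∈ Lw, a ≠ b ∧ a ≠ c ∧ a ≠ d ∧ c ≠ d ∧ b ≠ c := by
  by_cases hA : ∃ a ∈ L1, a ∉ Lw
  · obtain ⟨a, ha, haw⟩ := hA
    obtain ⟨b, hb, hb'⟩ := aux_pick L3 {a} 1 (by simp) (by omega)
    obtain ⟨c, hc, hc'⟩ := aux_pick L5 {a, b} 2 Finset.card_le_two (by omega)
    obtain ⟨d, hd, hd'⟩ := aux_pick Lw {c} 1 (by simp) (by omega)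
    exact ⟨a, ha, b, hb, c, hc, d, hd, by grind⟩
  by_cases hB : ∃ a ∈ L1, a ∉ L3
  · obtain ⟨a, ha, haw⟩ := hB
    obtain ⟨d, hd, hd'⟩ := aux_pick Lw {a} 1 (by simp) (by omega)
    obtain ⟨c, hc, hc'⟩ := aux_pick L5 {a, d} 2 Finset.card_le_two (by omega)
    obtain ⟨b, hb, hb'⟩ := aux_pick L3 {c} 1 (by simp) (by omega)
    exact ⟨a, ha, b, hb, c, hc, d, hd, by grind⟩
  push Not at hA hB
  obtain ⟨a, ha, b, hb, hab⟩ := Finset.one_lt_card.1 (show 1 < L1.card by omega)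
  obtain ⟨c, hc, hc'⟩ := aux_pick L5 {a, b} 2 Finset.card_le_two (by omega)
  exact ⟨a, ha, b, hB b hb, c, hc, b, hA b hb, by grind⟩

lemma aux_three {V : Type*} [Fintype V] (f : V → ℕ) (S : Set V) (a b c : V)
    (ha : a ∈ S) (hb : b ∈ S) (hc : c ∈ S) (h1 : f a ≠ f b) (h2 : f a ≠ f c) (h3 : f b ≠ f c) :
    3 ≤ (f '' S).ncard := by
  have e : ({f a, f b, f c} : Set ℕ).ncard = 3 := Set.ncard_eq_three.2 ⟨_, _, _, h1, h2, h3, rfl⟩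
  rw [← e]
  apply Set.ncard_le_ncard _ (Set.toFinite _)
  rintro x (rfl | rfl | rfl)
  exacts [⟨a, ha, rfl⟩, ⟨b, hb, rfl⟩, ⟨c, hc, rfl⟩]

lemma aux_two {V : Type*} [Fintype V] (f : V → ℕ) (S : Set V) (a b : V)
    (ha : a ∈ S) (hb : b ∈ S) (h1 : f a ≠ f b) :
    2 ≤ (f '' S).ncard := by
  rw [← Set.ncard_pair h1]
  apply Set.ncard_le_ncard _ (Set.toFinite _)
  rintro x (rfl | rfl)
  exacts [⟨a, ha, rfl⟩, ⟨b, hb, rfl⟩]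

lemma aux_eq2 {V : Type*} [Fintype V] (S : Set V) (a b : V) (ha : a ∈ S) (hb : b ∈ S)
    (hab : a ≠ b) (h : S.ncard = 2) : S = {a, b} := by
  symm
  refine Set.eq_of_subset_of_ncard_le ?_ ?_ (Set.toFinite _)
  · rintro x (rfl | rfl) <;> assumption
  · rw [Set.ncard_pair hab, h]

lemma aux_eq3 {V : Type*} [Fintype V] (S : Set V) (a b : V) (ha : a ∈ S) (hb : b ∈ S)
    (hab : a ≠ b) (h : S.ncard = 3) : ∃ c, c ≠ a ∧ c ≠ b ∧ S = {a, b, c} := by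
  obtain ⟨c, hc, hc'⟩ := Set.exists_mem_notMem_of_ncard_lt_ncard (s := {a, b}) (t := S)
    (by rw [Set.ncard_pair hab, h]; omega)
  have h1 : c ≠ a := by rintro rfl; simp at hc'
  have h2 : c ≠ b := by rintro rfl; simp at hc'
  refine ⟨c, h1, h2, ?_⟩
  symm
  refine Set.eq_of_subset_of_ncard_le ?_ ?_ (Set.toFinite _)
  · rintro x (rfl | rfl | rfl) <;> assumption
  · rw [h, Set.ncard_eq_three.2 ⟨a, b, c, hab, h1.symm, h2.symm, rfl⟩]

lemma aux_im2 {V : Type*} [Fintype V] (f : V → ℕ) (S : Set V) (h : 2 ≤ (f '' S).ncard) :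
    ∃ a ∈ S, ∃ b ∈ S, f a ≠ f b := by
  obtain ⟨p, q, hp, hq, hpq⟩ := (Set.one_lt_ncard_iff (Set.toFinite _)).1
    (show 1 < (f '' S).ncard by omega)
  obtain ⟨a, ha, rfl⟩ := hp
  obtain ⟨b, hb, rfl⟩ := hq
  exact ⟨a, ha, b, hb, hpq⟩

theorem min_counterexample_no_special_C5_configuration {V : Type*} [Fintype V]
    (G : SimpleGraph V) (k : ℕ) (hk : 6 ≤ k) (hG : ¬ Ch3dLE G k)
    (hmin : ProperSubgraphsCh3dLE G k) :
    ¬ ∃ v₁ v₂ v₃ v₄ v₅ w u : V,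
      ([v₁, v₂, v₃, v₄, v₅, w, u] : List V).Pairwise (· ≠ ·) ∧
      G.Adj v₁ v₂ ∧ G.Adj v₂ v₃ ∧ G.Adj v₃ v₄ ∧ G.Adj v₄ v₅ ∧ G.Adj v₅ v₁ ∧
      G.Adj w v₁ ∧ G.Adj w u ∧
      (G.neighborSet v₁).ncard = 3 ∧ (G.neighborSet v₂).ncard = 3 ∧
      (G.neighborSet v₃).ncard = 2 ∧ (G.neighborSet v₅).ncard = 2 ∧
      (G.neighborSet w).ncard = 2 ∧
      3 ≤ (G.neighborSet v₄).ncard ∧ 3 ≤ (G.neighborSet u).ncard := by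
  classical
  rintro ⟨v1, v2, v3, v4, v5, w, u, hne, a12, a23, a34, a45, a51, aw1, awu, d1, d2, d3, d5, dw,
    d4, du⟩
  apply hG
  intro L hL
  simp only [List.pairwise_cons, List.mem_cons, List.not_mem_nil, or_false, forall_eq_or_imp,
    forall_eq, List.Pairwise.nil, and_true, false_imp_iff, implies_true] at hne
  obtain ⟨⟨n12, n13, n14, n15, n1w, n1u⟩, ⟨n23, n24, n25, n2w, n2u⟩, ⟨n34, n35, n3w, n3u⟩,
    ⟨n45, n4w, n4u⟩, ⟨n5w, n5u⟩, nwu⟩ := hne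
  have N3 := aux_eq2 (G.neighborSet v3) v2 v4 a23.symm a34 n24 d3
  have N5 := aux_eq2 (G.neighborSet v5) v1 v4 a51 a45.symm n14 d5
  have Nw := aux_eq2 (G.neighborSet w) v1 u aw1 awu n1u dw
  obtain ⟨x, x1, x3, N2⟩ := aux_eq3 (G.neighborSet v2) v1 v3 a12.symm a23 n13 d2
  have N1 : G.neighborSet v1 = {v2, v5, w} := by
    obtain ⟨c, hc, hc', h⟩ := aux_eq3 (G.neighborSet v1) v2 v5 a12 a51.symm n25 d1
    have : w ∈ G.neighborSet v1 := aw1.symm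
    rw [h] at this ⊢
    rcases this with rfl | rfl | rfl
    · exact absurd rfl n2w
    · exact absurd rfl n5w
    · rfl
  have A1 : ∀ y, G.Adj v1 y ↔ y = v2 ∨ y = v5 ∨ y = w := fun y => by
    rw [← SimpleGraph.mem_neighborSet, N1]; simp
  have A2 : ∀ y, G.Adj v2 y ↔ y = v1 ∨ y = v3 ∨ y = x := fun y => by
    rw [← SimpleGraph.mem_neighborSet, N2]; simp
  have A3 : ∀ y, G.Adj v3 y ↔ y = v2 ∨ y = v4 := fun y => by
    rw [← SimpleGraph.mem_neighborSet, N3]; simp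
  have A5 : ∀ y, G.Adj v5 y ↔ y = v1 ∨ y = v4 := fun y => by
    rw [← SimpleGraph.mem_neighborSet, N5]; simp
  have Aw : ∀ y, G.Adj w y ↔ y = v1 ∨ y = u := fun y => by
    rw [← SimpleGraph.mem_neighborSet, Nw]; simp
  have a2x : G.Adj v2 x := (A2 x).2 (by simp)
  have x2 : x ≠ v2 := a2x.ne'
  have x5 : x ≠ v5 := by
    rintro rfl; have := (A5 v2).1 a2x.symm; grind
  have xw : x ≠ w := by
    rintro rfl; have := (Aw v2).1 a2x.symm; grind
  let D : Set V := {v1, v5, w}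
  have memD : ∀ y, y ∉ D ↔ y ≠ v1 ∧ y ≠ v5 ∧ y ≠ w := fun y => by simp [D]
  obtain ⟨ψ, hψL, hψp, hψd⟩ := aux_ext G k hmin D ⟨v1, by simp [D]⟩ L hL
  have D2 : v2 ∉ D := (memD _).2 ⟨n12.symm, n25, n2w⟩
  have D3 : v3 ∉ D := (memD _).2 ⟨n13.symm, n35, n3w⟩
  have D4 : v4 ∉ D := (memD _).2 ⟨n14.symm, n45, n4w⟩
  have Du : u ∉ D := (memD _).2 ⟨n1u.symm, n5u.symm, nwu.symm⟩
  have Dx : x ∉ D := (memD _).2 ⟨x1, x5, xw⟩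
  -- facts about ψ
  have p23 : ψ v2 ≠ ψ v3 := hψp _ _ D2 D3 a23
  have p34 : ψ v3 ≠ ψ v4 := hψp _ _ D3 D4 a34
  have p2x : ψ v2 ≠ ψ x := hψp _ _ D2 Dx a2x
  have p24 : ψ v2 ≠ ψ v4 := by
    have h := hψd v3 D3
    have e : G.neighborSet v3 \ D = {v2, v4} := by
      rw [N3]; ext y; simp only [D, Set.mem_sdiff, Set.mem_insert_iff, Set.mem_singleton_iff]; grind
    rw [e, Set.ncard_pair n24] at h
    intro h'
    rw [Set.image_pair, h'] at h
    simp at h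
  have p3x : ψ v3 ≠ ψ x := by
    have h := hψd v2 D2
    have e : G.neighborSet v2 \ D = {v3, x} := by
      rw [N2]; ext y; simp only [D, Set.mem_sdiff, Set.mem_insert_iff, Set.mem_singleton_iff]; grind
    rw [e, Set.ncard_pair x3.symm] at h
    intro h'
    rw [Set.image_pair, h'] at h
    simp at h
  obtain ⟨y1, ⟨y1u, y1D⟩, y2, ⟨y2u, y2D⟩, hy12⟩ : ∃ a ∈ G.neighborSet u \ D,
      ∃ b ∈ G.neighborSet u \ D, ψ a ≠ ψ b := by
    apply aux_im2
    refine le_trans ?_ (hψd u Du)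
    have e : G.neighborSet u \ D = G.neighborSet u \ {w} := by
      ext y
      simp only [D, Set.mem_sdiff, Set.mem_insert_iff, Set.mem_singleton_iff,
        SimpleGraph.mem_neighborSet]
      have h1 := A1 u
      have h5 := A5 u
      have := G.adj_comm u v1
      have := G.adj_comm u v5
      grind
    rw [e]
    have := Set.ncard_sdiff_singleton_of_mem (s := G.neighborSet u) (a := w) awu.symm
    omega
  rw [SimpleGraph.mem_neighborSet] at y1u y2u
  rw [memD] at y1D y2D
  have nu3 : ¬ G.Adj u v3 := fun h => by have := (A3 u).1 h.symm; grind
  have y13 : y1 ≠ v3 := by rintro rfl; exact nu3 y1u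
  have y23 : y2 ≠ v3 := by rintro rfl; exact nu3 y2u
  -- the finishing step
  have finish : ∀ a ∈ L v1, ∀ b ∈ L v3, ∀ c ∈ L v5, ∀ d ∈ L w,
      a ≠ ψ v2 → a ≠ ψ v4 → a ≠ ψ u → a ≠ ψ x → a ≠ b → a ≠ c → a ≠ d →
      b ≠ ψ v2 → b ≠ ψ v4 → b ≠ ψ x → c ≠ ψ v2 → c ≠ ψ v4 → c ≠ d →
      d ≠ ψ v2 → d ≠ ψ u → d ≠ ψ y1 → d ≠ ψ y2 →
      (∀ f : V → ℕ, f v3 = b → f v5 = c → (∀ y, y ∉ D → y ≠ v3 → f y = ψ y) →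
        3 ≤ (f '' G.neighborSet v4).ncard) → Dyn3ListColorable G L := by
    intro a ha b hb c hc d hd a2 a4 au ax ab ac ad b2 b4 bx c2 c4 cd d2 du' dy1 dy2 h4
    let f : V → ℕ := fun y => if y = v1 then a else if y = v3 then b else if y = v5 then c
      else if y = w then d else ψ y
    have f1 : f v1 = a := by simp [f]
    have f3 : f v3 = b := by simp [f, n13.symm]
    have f5 : f v5 = c := by simp [f, n15.symm, n35.symm]
    have fw : f w = d := by simp [f, n1w.symm, n3w.symm, n5w.symm]
    have fo : ∀ y, y ∉ D → y ≠ v3 → f y = ψ y := by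
      intro y hy h3
      rw [memD] at hy
      simp [f, hy, h3]
    have f2 := fo v2 D2 n23
    have f4 := fo v4 D4 n34.symm
    have fu := fo u Du n3u.symm
    have fx := fo x Dx x3
    have fy1 := fo y1 ((memD _).2 y1D) y13
    have fy2 := fo y2 ((memD _).2 y2D) y23
    have key : ∀ y z, (y = v1 ∨ y = v3 ∨ y = v5 ∨ y = w) → G.Adj y z → f y ≠ f z := by
      intro y z hy hyz
      rcases hy with rfl | rfl | rfl | rfl
      · rcases (A1 z).1 hyz with rfl | rfl | rfl <;> grind
      · rcases (A3 z).1 hyz with rfl | rfl <;> grind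
      · rcases (A5 z).1 hyz with rfl | rfl <;> grind
      · rcases (Aw z).1 hyz with rfl | rfl <;> grind
    refine ⟨f, ⟨?_, ?_⟩, ?_⟩
    · intro y z hyz
      by_cases hy : (y = v1 ∨ y = v3 ∨ y = v5 ∨ y = w)
      · exact key y z hy hyz
      by_cases hz : (z = v1 ∨ z = v3 ∨ z = v5 ∨ z = w)
      · exact (key z y hz hyz.symm).symm
      push Not at hy hz
      have Dy : y ∉ D := (memD _).2 ⟨hy.1, hy.2.2.1, hy.2.2.2⟩
      have Dz : z ∉ D := (memD _).2 ⟨hz.1, hz.2.2.1, hz.2.2.2⟩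
      rw [fo y Dy hy.2.1, fo z Dz hz.2.1]
      exact hψp _ _ Dy Dz hyz
    · intro y
      by_cases e1 : y = v1
      · rw [e1]
        refine le_trans (min_le_left _ _) (aux_three f _ v2 v5 w a12 a51.symm aw1.symm ?_ ?_ ?_)
          <;> grind
      by_cases e2 : y = v2
      · rw [e2]
        refine le_trans (min_le_left _ _) (aux_three f _ v1 v3 x a12.symm a23 a2x ?_ ?_ ?_)
          <;> grind
      by_cases e3 : y = v3
      · rw [e3, d3]
        refine le_trans (min_le_right _ _) (aux_two f _ v2 v4 a23.symm a34 ?_)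
        grind
      by_cases e4 : y = v4
      · rw [e4]
        exact le_trans (min_le_left _ _) (h4 f f3 f5 fo)
      by_cases e5 : y = v5
      · rw [e5, d5]
        refine le_trans (min_le_right _ _) (aux_two f _ v1 v4 a51 a45.symm ?_)
        grind
      by_cases ew : y = w
      · rw [ew, dw]
        refine le_trans (min_le_right _ _) (aux_two f _ v1 u aw1 awu ?_)
        grind
      by_cases eu : y = u
      · rw [eu]
        refine le_trans (min_le_left _ _) (aux_three f _ w y1 y2 awu.symm y1u y2u ?_ ?_ ?_)
          <;> grind
      have Dy : y ∉ D := (memD _).2 ⟨e1, e5, ew⟩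
      have hn1 : ¬ G.Adj y v1 := fun h => by have := (A1 y).1 h.symm; grind
      have hn3 : ¬ G.Adj y v3 := fun h => by have := (A3 y).1 h.symm; grind
      have hn5 : ¬ G.Adj y v5 := fun h => by have := (A5 y).1 h.symm; grind
      have hnw : ¬ G.Adj y w := fun h => by have := (Aw y).1 h.symm; grind
      have hz : ∀ z ∈ G.neighborSet y, z ∉ D := by
        intro z hz
        rw [SimpleGraph.mem_neighborSet] at hz
        rw [memD]
        refine ⟨?_, ?_, ?_⟩ <;> rintro rfl <;> contradiction
      have e : G.neighborSet y \ D = G.neighborSet y :=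
        Set.ext fun z => ⟨fun h => h.1, fun h => ⟨h, hz z h⟩⟩
      have h := hψd y Dy
      rw [e] at h
      have e' : f '' G.neighborSet y = ψ '' G.neighborSet y := by
        apply Set.image_congr
        intro z hz'
        apply fo z (hz z hz')
        rintro rfl
        exact hn3 hz'
      rw [e']
      exact h
    · intro y
      by_cases e1 : y = v1
      · rw [e1, f1]; exact ha
      by_cases e3 : y = v3
      · rw [e3, f3]; exact hb
      by_cases e5 : y = v5
      · rw [e5, f5]; exact hc
      by_cases ew : y = w
      · rw [ew, fw]; exact hd
      have Dy : y ∉ D := (memD _).2 ⟨e1, e5, ew⟩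
      rw [fo y Dy e3]
      exact hψL y Dy
  have hL6 : ∀ v, 6 ≤ (L v).card := fun v => hk.trans (hL v)
  have N4D : G.neighborSet v4 \ D = G.neighborSet v4 \ {v5} := by
    ext y
    simp only [D, Set.mem_sdiff, Set.mem_insert_iff, Set.mem_singleton_iff,
      SimpleGraph.mem_neighborSet]
    have h1 := A1 v4
    have h5 := Aw v4
    have := G.adj_comm v4 v1
    have := G.adj_comm v4 w
    grind
  have card4 := Set.ncard_sdiff_singleton_of_mem (s := G.neighborSet v4) (a := v5) a45
  have hd4 := hψd v4 D4
  by_cases hc4 : (G.neighborSet v4).ncard = 3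
  · obtain ⟨z, z3, z5, N4⟩ := aux_eq3 (G.neighborSet v4) v3 v5 a34.symm a45 n35 hc4
    have a4z : z ∈ G.neighborSet v4 := by rw [N4]; simp
    have zD : z ∉ D := by
      have : z ∈ G.neighborSet v4 \ D := by rw [N4D]; exact ⟨a4z, z5⟩
      exact this.2
    have c1 : 2 ≤ (L v1 \ {ψ v2, ψ v4, ψ u, ψ x}).card := by
      have := Finset.le_card_sdiff {ψ v2, ψ v4, ψ u, ψ x} (L v1)
      have := hL6 v1
      have : ({ψ v2, ψ v4, ψ u, ψ x} : Finset ℕ).card ≤ 4 := Finset.card_le_four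
      omega
    have c3 : 2 ≤ (L v3 \ {ψ v2, ψ v4, ψ x, ψ z}).card := by
      have := Finset.le_card_sdiff {ψ v2, ψ v4, ψ x, ψ z} (L v3)
      have := hL6 v3
      have : ({ψ v2, ψ v4, ψ x, ψ z} : Finset ℕ).card ≤ 4 := Finset.card_le_four
      omega
    have c5 : 3 ≤ (L v5 \ {ψ v2, ψ v4, ψ z}).card := by
      have := Finset.le_card_sdiff {ψ v2, ψ v4, ψ z} (L v5)
      have := hL6 v5
      have : ({ψ v2, ψ v4, ψ z} : Finset ℕ).card ≤ 3 := Finset.card_le_three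
      omega
    have cw : 2 ≤ (L w \ {ψ v2, ψ u, ψ y1, ψ y2}).card := by
      have := Finset.le_card_sdiff {ψ v2, ψ u, ψ y1, ψ y2} (L w)
      have := hL6 w
      have : ({ψ v2, ψ u, ψ y1, ψ y2} : Finset ℕ).card ≤ 4 := Finset.card_le_four
      omega
    obtain ⟨a, ha, b, hb, c, hc, d, hd, ab, ac, ad, cd, bc⟩ := aux_comb _ _ _ _ c1 c3 c5 cw
    simp only [Finset.mem_sdiff, Finset.mem_insert, Finset.mem_singleton, not_or] at ha hb hc hd
    obtain ⟨haL, ha1, ha2, ha3, ha4⟩ := ha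
    obtain ⟨hbL, hb1, hb2, hb3, hb4⟩ := hb
    obtain ⟨hcL, hc1, hc2, hc3⟩ := hc
    obtain ⟨hdL, hd1, hd2, hd3, hd4⟩ := hd
    refine finish a haL b hbL c hcL d hdL ha1 ha2 ha3 ha4 ab ac ad hb1 hb2 hb3 hc1 hc2 cd
      hd1 hd2 hd3 hd4 ?_
    intro f f3 f5 fo
    have fz := fo z zD z3
    refine aux_three f _ v3 v5 z a34.symm a45 a4z ?_ ?_ ?_ <;> grind
  · have h3 : 3 ≤ (ψ '' (G.neighborSet v4 \ D)).ncard := by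
      rw [← N4D] at card4
      omega
    obtain ⟨a, haL, ha⟩ := aux_pick (L v1) {ψ v2, ψ v4, ψ u, ψ x, ψ v3} 5 Finset.card_le_five
      (hL6 v1)
    obtain ⟨d, hdL, hd⟩ := aux_pick (L w) {ψ v2, ψ u, ψ y1, ψ y2, a} 5 Finset.card_le_five
      (hL6 w)
    obtain ⟨c, hcL, hc⟩ := aux_pick (L v5) {ψ v2, ψ v4, a, d} 5
      (Finset.card_le_four.trans (by norm_num)) (hL6 v5)
    simp only [Finset.mem_insert, Finset.mem_singleton, not_or] at ha hc hd
    obtain ⟨ha1, ha2, ha3, ha4, ha5⟩ := ha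
    obtain ⟨hc1, hc2, hc3, hc4⟩ := hc
    obtain ⟨hd1, hd2, hd3, hd4, hd5⟩ := hd
    refine finish a haL (ψ v3) (hψL v3 D3) c hcL d hdL ha1 ha2 ha3 ha4 ha5 (Ne.symm hc3)
      (Ne.symm hd5) p23.symm p34 p3x hc1 hc2 hc4 hd1 hd2 hd3 hd4 ?_
    intro f f3 f5 fo
    refine h3.trans ?_
    have e : ψ '' (G.neighborSet v4 \ D) = f '' (G.neighborSet v4 \ D) := by
      apply Set.image_congr
      intro y hy
      by_cases h : y = v3
      · rw [h, f3]
      · exact (fo y hy.2 h).symm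
    rw [e]
    exact Set.ncard_le_ncard (Set.image_mono Set.diff_subset) (Set.toFinite _)
end

section
/- Let F be a finite simple graph with mad(F) ≤ 18/7, let x and y be two vertices of F, and let F' be the graph obtained from F by adding a new path of length ℓ ≥ 5 from x to y whose ℓ − 1 internal vertices are new vertices not in F. Then mad(F') ≤ 18/7. -/
open SimpleGraph

/-- The graph obtained from `F` by adding a path of length `ℓ` from `x` to `y`
whose `ℓ - 1` internal vertices are new. -/
def addPath {V : Type*} (F : SimpleGraph V) (x y : V) (ℓ : ℕ) :
    SimpleGraph (V ⊕ Fin (ℓ - 1)) :=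
  SimpleGraph.fromRel (fun a b =>
    match a, b with
    | Sum.inl a, Sum.inl b => F.Adj a b
    | Sum.inl a, Sum.inr i => (a = x ∧ i.val = 0) ∨ (a = y ∧ i.val = ℓ - 2)
    | Sum.inr i, Sum.inr j => j.val = i.val + 1
    | Sum.inr _, Sum.inl _ => False)

theorem new_edges_aux {V : Type*} [Fintype V] (F : SimpleGraph V) (x y : V)
    (ℓ : ℕ) (hℓ : 5 ≤ ℓ) (H : (addPath F x y ℓ).Subgraph) :
    7 * {e ∈ H.edgeSet | ∃ i b, e = s(Sum.inr i, b)}.ncard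
      ≤ 9 * (Sum.inr ⁻¹' H.verts : Set (Fin (ℓ - 1))).ncard := by
  classical
  let L : Fin (ℓ - 1) → Sym2 (V ⊕ Fin (ℓ - 1)) := fun i =>
    if i.val = 0 then s(Sum.inl x, Sum.inr i)
    else s(Sum.inr ⟨i.val - 1, by omega⟩, Sum.inr i)
  let R : Fin (ℓ - 1) → Sym2 (V ⊕ Fin (ℓ - 1)) := fun i =>
    if h : i.val + 1 < ℓ - 1 then s(Sum.inr i, Sum.inr ⟨i.val + 1, h⟩)
    else s(Sum.inr i, Sum.inl y)
  -- classification of new edges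
  have key : ∀ e ∈ H.edgeSet, (∃ i b, e = s(Sum.inr i, b)) →
      (∃ i : Fin (ℓ - 1), i.val = 0 ∧ Sum.inr i ∈ H.verts ∧ e = L i) ∨
      (∃ i : Fin (ℓ - 1), i.val + 1 = ℓ - 1 ∧ Sum.inr i ∈ H.verts ∧ e = R i) ∨
      (∃ i j : Fin (ℓ - 1), j.val = i.val + 1 ∧ Sum.inr i ∈ H.verts ∧ Sum.inr j ∈ H.verts ∧
        e = R i ∧ e = L j) := by
    rintro e he ⟨i, b, rfl⟩
    have hadj : H.Adj (Sum.inr i) b := he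
    have hi := H.edge_vert hadj
    have hb := H.edge_vert hadj.symm
    have hG := H.adj_sub hadj
    have aux : ∀ i j : Fin (ℓ - 1), j.val = i.val + 1 →
        (s(Sum.inr i, Sum.inr j) : Sym2 (V ⊕ Fin (ℓ - 1))) = R i ∧
        (s(Sum.inr i, Sum.inr j) : Sym2 (V ⊕ Fin (ℓ - 1))) = L j := by
      intro i j hij
      have hj := j.isLt
      constructor
      · have h : i.val + 1 < ℓ - 1 := by omega
        have : j = ⟨i.val + 1, h⟩ := Fin.ext hij
        simp only [R, dif_pos h, ← this]
      · have h : j.val ≠ 0 := by omega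
        have : i = ⟨j.val - 1, by omega⟩ := Fin.ext (by simp; omega)
        simp only [L, if_neg h, ← this]
    rcases b with a | j
    · simp only [addPath, SimpleGraph.fromRel_adj, false_or] at hG
      rcases hG.2 with ⟨rfl, h⟩ | ⟨rfl, h⟩
      · left
        exact ⟨i, h, hi, by simp only [L, if_pos h]; exact Sym2.eq_swap⟩
      · right; left
        exact ⟨i, by omega, hi, by
          have : ¬ (i.val + 1 < ℓ - 1) := by omega
          simp only [R, dif_neg this]⟩
    · simp only [addPath, SimpleGraph.fromRel_adj] at hG
      right; right
      rcases hG.2 with h | h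
      · exact ⟨i, j, h, hi, hb, aux i j h⟩
      · refine ⟨j, i, h, hb, hi, ?_⟩
        rw [Sym2.eq_swap]
        exact aux j i h
  by_cases hfull : ∀ i, (Sum.inr i : V ⊕ Fin (ℓ - 1)) ∈ H.verts
  · have h1 : (Sum.inr ⁻¹' H.verts : Set (Fin (ℓ - 1))) = Set.univ := by
      ext i; simp [hfull i]
    have h2 : {e ∈ H.edgeSet | ∃ i b, e = s(Sum.inr i, b)} ⊆
        insert (L ⟨0, by omega⟩) (R '' Set.univ) := by
      rintro e ⟨he, hn⟩
      rcases key e he hn with ⟨i, h0, -, rfl⟩ | ⟨i, -, -, rfl⟩ | ⟨i, j, -, -, -, rfl, -⟩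
      · left; congr 1; exact Fin.ext h0
      · right; exact ⟨i, trivial, rfl⟩
      · right; exact ⟨i, trivial, rfl⟩
    have h3 := Set.ncard_le_ncard h2 (Set.toFinite _)
    have h4 := Set.ncard_insert_le (L ⟨0, by omega⟩) (R '' Set.univ)
    have h5 := Set.ncard_image_le (f := R) (Set.toFinite Set.univ)
    rw [h1]
    rw [Set.ncard_univ, Nat.card_fin] at *
    omega
  · push Not at hfull
    obtain ⟨k, hk⟩ := hfull
    have h2 : {e ∈ H.edgeSet | ∃ i b, e = s(Sum.inr i, b)} ⊆
        (fun i => if i < k then L i else R i) '' (Sum.inr ⁻¹' H.verts) := by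
      rintro e ⟨he, hn⟩
      have ne : ∀ i : Fin (ℓ - 1), (Sum.inr i : V ⊕ Fin (ℓ - 1)) ∈ H.verts → i.val ≠ k.val := by
        intro i hi h
        exact hk (Fin.ext h ▸ hi)
      rcases key e he hn with ⟨i, h0, hi, rfl⟩ | ⟨i, h0, hi, rfl⟩ | ⟨i, j, hij, hi, hj, h1, h2⟩
      · have := ne i hi
        exact ⟨i, hi, if_pos (Fin.lt_def.2 (by omega))⟩
      · have := ne i hi
        exact ⟨i, hi, if_neg (by rw [Fin.lt_def]; omega)⟩
      · have n1 := ne i hi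
        have n2 := ne j hj
        by_cases hlt : j < k
        · exact ⟨j, hj, by simp only [if_pos hlt]; exact h2.symm⟩
        · have : ¬ i < k := by rw [Fin.lt_def] at *; omega
          exact ⟨i, hi, by simp only [if_neg this]; exact h1.symm⟩
    have h3 := Set.ncard_le_ncard h2 (Set.toFinite _)
    have h5 := Set.ncard_image_le (f := fun i => if i < k then L i else R i)
      (Set.toFinite (Sum.inr ⁻¹' H.verts : Set (Fin (ℓ - 1))))
    omega

theorem mad_le_addPath {V : Type*} [Fintype V] (F : SimpleGraph V) (x y : V)
    (hxy : x ≠ y) (ℓ : ℕ) (hℓ : 5 ≤ ℓ) (hF : MadLE F (18 / 7)) :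
    MadLE (addPath F x y ℓ) (18 / 7) := by
  classical
  intro H hne
  have hnew := new_edges_aux F x y ℓ hℓ H
  let K : F.Subgraph :=
    { verts := Sum.inl ⁻¹' H.verts
      Adj := fun a b => H.Adj (Sum.inl a) (Sum.inl b)
      adj_sub := by
        intro a b h
        have hG := H.adj_sub h
        simp only [addPath, SimpleGraph.fromRel_adj] at hG
        rcases hG.2 with h | h
        · exact h
        · exact h.symm
      edge_vert := fun h => H.edge_vert h
      symm := ⟨fun a b h => SimpleGraph.Subgraph.Adj.symm h⟩ }
  have hold : 7 * K.edgeSet.ncard ≤ 9 * K.verts.ncard := by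
    by_cases hK : K.verts.Nonempty
    · have h := hF K hK
      have hpos : (0 : ℚ) < K.verts.ncard := by
        exact_mod_cast (Set.ncard_pos (Set.toFinite _)).2 hK
      rw [div_le_iff₀ hpos] at h
      have : (7 * K.edgeSet.ncard : ℚ) ≤ 9 * K.verts.ncard := by linarith
      exact_mod_cast this
    · have : K.edgeSet = ∅ := by
        rw [Set.eq_empty_iff_forall_notMem]
        intro e
        induction e using Sym2.ind with
        | _ a b => exact fun h => hK ⟨a, K.edge_vert h⟩
      simp [this]
  have hsub : H.edgeSet ⊆ (Sym2.map Sum.inl '' K.edgeSet) ∪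
      {e ∈ H.edgeSet | ∃ i b, e = s(Sum.inr i, b)} := by
    intro e
    induction e using Sym2.ind with
    | _ a b =>
      intro h
      rcases a with a | i
      · rcases b with b | j
        · left; exact ⟨s(a, b), h, rfl⟩
        · right; exact ⟨h, j, _, Sym2.eq_swap⟩
      · right; exact ⟨h, i, _, rfl⟩
  have hE := Set.ncard_le_ncard hsub (Set.toFinite _)
  have hE2 := Set.ncard_union_le (Sym2.map Sum.inl '' K.edgeSet)
      {e ∈ H.edgeSet | ∃ i b, e = s(Sum.inr i, b)}
  have hE3 := Set.ncard_image_le (f := Sym2.map (Sum.inl : V → V ⊕ Fin (ℓ - 1)))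
    (Set.toFinite K.edgeSet)
  have hV : H.verts.ncard = K.verts.ncard +
      (Sum.inr ⁻¹' H.verts : Set (Fin (ℓ - 1))).ncard := by
    rw [← Set.ncard_image_of_injective K.verts (Sum.inl_injective (β := Fin (ℓ - 1))),
      ← Set.ncard_image_of_injective (Sum.inr ⁻¹' H.verts) (Sum.inr_injective (α := V)),
      ← Set.ncard_union_eq _ (Set.toFinite _) (Set.toFinite _)]
    · congr 1
      ext v
      rcases v with v | v <;> simp [K]
    · rw [Set.disjoint_left]
      rintro _ ⟨a, -, rfl⟩ ⟨b, -, h⟩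
      simp at h
  have hpos : (0 : ℚ) < H.verts.ncard := by
    exact_mod_cast (Set.ncard_pos (Set.toFinite _)).2 hne
  rw [div_le_iff₀ hpos]
  have : 7 * H.edgeSet.ncard ≤ 9 * H.verts.ncard := by omega
  have : (7 * H.edgeSet.ncard : ℚ) ≤ 9 * H.verts.ncard := by exact_mod_cast this
  linarith
end
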